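/- arXiv:0907.2142 — 3 statements merged into one kernel-verified Lean document; each statement's English description precedes it below -/
import Mathlib

section
/- Let c ∈ ℝ and φ : ℝ → ℝ be continuous. For C² functions f, g : ℝ → ℝ define L_{R,cn}(f,g) = ( −f'' + 2cf − 2φf − 2√2·φg , −2√2·φf − g'' + 2cg ). Then for all C² functions f, g and all x ∈ ℝ: (L_{R,cn}(f,g))₁ + (1/√2)(L_{R,cn}(f,g))₂ = −p'' + 2cp − 4φp where p = f + (1/√2)g, and −(1/√2)(L_{R,cn}(f,g))₁ + (L_{R,cn}(f,g))₂ = −q'' + 2cq + 2φq where q = −(1/√2)f + g. That is, the similarity transformation by the matrix A_R = [[1, 1/√2],[−1/√2, 1]] diagonalizes L_{R,cn} into diag(L_{1,cn}, L_{3,cn}) with L_{1,cn} = −d²/dx² + 2c − 4φ and L_{3,cn} = −d²/dx² + 2c + 2φ. -/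
/-- The second derivative of a linear combination of two `C²` functions. -/
theorem deriv_deriv_linear_combination {f g : ℝ → ℝ} (hf : ContDiff ℝ 2 f)
    (hg : ContDiff ℝ 2 g) (a b x : ℝ) :
    deriv (deriv (fun y : ℝ => a * f y + b * g y)) x
      = a * deriv (deriv f) x + b * deriv (deriv g) x := by
  have hdd {h : ℝ → ℝ} (hh : ContDiff ℝ 2 h) :
      Differentiable ℝ h ∧ Differentiable ℝ (deriv h) :=
    ⟨hh.differentiable (by norm_num),
      ((contDiff_succ_iff_deriv (n := 1)).1 hh).2.2.differentiable (by norm_num)⟩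
  have hcomb {u v : ℝ → ℝ} (hu : Differentiable ℝ u) (hv : Differentiable ℝ v) :
      deriv (fun y : ℝ => a * u y + b * v y) = fun y => a * deriv u y + b * deriv v y :=
    funext fun y => (((hu y).hasDerivAt.const_mul a).add ((hv y).hasDerivAt.const_mul b)).deriv
  rw [hcomb (hdd hf).1 (hdd hg).1, hcomb (hdd hf).2 (hdd hg).2]

/-- The similarity transformation by `A_R = [[1, 1/√2], [−1/√2, 1]]` diagonalizes the
matrix operator `L_{R,cn}` into `diag(L_{1,cn}, L_{3,cn})` with
`L_{1,cn} = −d²/dx² + 2c − 4φ` and `L_{3,cn} = −d²/dx² + 2c + 2φ`. -/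
theorem diagonalization_LRcn
    (c : ℝ) (φ : ℝ → ℝ) (hφ : Continuous φ) :
    ∀ f g : ℝ → ℝ, ContDiff ℝ 2 f → ContDiff ℝ 2 g → ∀ x : ℝ,
      ((-deriv (deriv f) x + 2 * c * f x - 2 * φ x * f x - 2 * Real.sqrt 2 * φ x * g x)
          + (1 / Real.sqrt 2) *
            (-2 * Real.sqrt 2 * φ x * f x - deriv (deriv g) x + 2 * c * g x)
        = -deriv (deriv (fun y : ℝ => f y + (1 / Real.sqrt 2) * g y)) x
            + 2 * c * (f x + (1 / Real.sqrt 2) * g x)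
            - 4 * φ x * (f x + (1 / Real.sqrt 2) * g x))
      ∧ (-(1 / Real.sqrt 2) *
            (-deriv (deriv f) x + 2 * c * f x - 2 * φ x * f x - 2 * Real.sqrt 2 * φ x * g x)
          + (-2 * Real.sqrt 2 * φ x * f x - deriv (deriv g) x + 2 * c * g x)
        = -deriv (deriv (fun y : ℝ => -(1 / Real.sqrt 2) * f y + g y)) x
            + 2 * c * (-(1 / Real.sqrt 2) * f x + g x)
            + 2 * φ x * (-(1 / Real.sqrt 2) * f x + g x)) := by
  intro f g hf hg x
  have hs : Real.sqrt 2 * Real.sqrt 2 = 2 := Real.mul_self_sqrt (by norm_num)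
  have hinv : 1 / Real.sqrt 2 = Real.sqrt 2 / 2 := by
    rw [div_eq_div_iff (by positivity) (by norm_num), hs, one_mul]
  have hp := deriv_deriv_linear_combination hf hg 1 (1 / Real.sqrt 2) x
  have hq := deriv_deriv_linear_combination hf hg (-(1 / Real.sqrt 2)) 1 x
  simp only [one_mul] at hp hq
  rw [hp, hq, hinv]
  constructor
  · linear_combination (-φ x * f x) * hs
  · linear_combination (φ x * g x) * hs
end

section
/- Let L > 0, let q : ℝ → ℝ be continuous, and suppose φ : ℝ → ℝ is a C², L-periodic function with φ(x) > 0 for all x and −φ'' + qφ = 0 on ℝ. If ψ : ℝ → ℝ is any C², L-periodic function with −ψ'' + qψ = 0 on ℝ, then there exists a constant α ∈ ℝ with ψ = α·φ. -/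
/-- The Wronskian of two C² solutions of `−y'' + qy = 0` is constant. -/
theorem wronskian_eq_of_hill {q φ ψ : ℝ → ℝ} (hφ : ContDiff ℝ 2 φ) (hψ : ContDiff ℝ 2 ψ)
    (hodeφ : ∀ x : ℝ, -deriv (deriv φ) x + q x * φ x = 0)
    (hodeψ : ∀ x : ℝ, -deriv (deriv ψ) x + q x * ψ x = 0) (x y : ℝ) :
    deriv ψ x * φ x - ψ x * deriv φ x = deriv ψ y * φ y - ψ y * deriv φ y := by
  have hφ₁ := hφ.differentiable two_ne_zero
  have hψ₁ := hψ.differentiable two_ne_zero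
  have hφ₂ := hφ.differentiable_deriv_two
  have hψ₂ := hψ.differentiable_deriv_two
  have hW (z : ℝ) : HasDerivAt (fun z => deriv ψ z * φ z - ψ z * deriv φ z) 0 z := by
    refine (((hψ₂ z).hasDerivAt.mul (hφ₁ z).hasDerivAt).sub
      ((hψ₁ z).hasDerivAt.mul (hφ₂ z).hasDerivAt)).congr_deriv ?_
    linear_combination ψ z * hodeφ z - φ z * hodeψ z
  exact is_const_of_deriv_eq_zero (fun z => (hW z).differentiableAt) (fun z => (hW z).deriv) x y


/-- If the Hill operator `−d²/dx² + q` (with `q` continuous) has a strictly positive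
C² `L`-periodic solution `φ` of `−φ'' + qφ = 0`, then the `L`-periodic null space is
one-dimensional: any C² `L`-periodic solution `ψ` is a multiple of `φ`. -/
theorem hill_positive_kernel_simple
    (L : ℝ) (hL : 0 < L)
    (q : ℝ → ℝ) (hq : Continuous q)
    (φ : ℝ → ℝ) (hφ : ContDiff ℝ 2 φ) (hφper : ∀ x : ℝ, φ (x + L) = φ x)
    (hφpos : ∀ x : ℝ, 0 < φ x)
    (hodeφ : ∀ x : ℝ, -deriv (deriv φ) x + q x * φ x = 0)
    (ψ : ℝ → ℝ) (hψ : ContDiff ℝ 2 ψ) (hψper : ∀ x : ℝ, ψ (x + L) = ψ x)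
    (hodeψ : ∀ x : ℝ, -deriv (deriv ψ) x + q x * ψ x = 0) :
    ∃ α : ℝ, ∀ x : ℝ, ψ x = α * φ x := by
  have hu (x : ℝ) : HasDerivAt (fun x => ψ x / φ x)
      ((deriv ψ x * φ x - ψ x * deriv φ x) / φ x ^ 2) x :=
    (hψ.differentiable two_ne_zero x).hasDerivAt.div
      (hφ.differentiable two_ne_zero x).hasDerivAt (hφpos x).ne'
  have hper : ψ 0 / φ 0 = ψ L / φ L := by
    rw [← hφper 0, ← hψper 0, zero_add]
  obtain ⟨c, -, hc⟩ := exists_hasDerivAt_eq_zero hL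
    (fun x _ => (hu x).continuousAt.continuousWithinAt) hper (fun x _ => hu x)
  have hWc : deriv ψ c * φ c - ψ c * deriv φ c = 0 :=
    (div_eq_zero_iff.mp hc).resolve_right (pow_ne_zero 2 (hφpos c).ne')
  refine ⟨ψ 0 / φ 0, fun x => ?_⟩
  rw [← div_eq_iff (hφpos x).ne']
  refine is_const_of_deriv_eq_zero (fun z => (hu z).differentiableAt) (fun z => ?_) x 0
  rw [(hu z).deriv, wronskian_eq_of_hill hφ hψ hodeφ hodeψ z c, hWc, zero_div]
end

section
/- For every k ∈ (0,1): 2 + 5k² − 2√(1 − k² + 4k⁴) < 5 + 2k² − 2√(4 − k² + k⁴) < 5 + 5k² − 2√(4 − 7k² + 4k⁴) < 4 + 4k². -/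
/-- Interlacing of the periodic and semi-periodic Lamé eigenvalues:
`δ₀ < δ̃₀ < δ̃₁ < δ₁` for every `k ∈ (0,1)`. -/
theorem lame_eigenvalue_interlacing
    (k : ℝ) (hk0 : 0 < k) (hk1 : k < 1) :
    2 + 5 * k ^ 2 - 2 * Real.sqrt (1 - k ^ 2 + 4 * k ^ 4)
        < 5 + 2 * k ^ 2 - 2 * Real.sqrt (4 - k ^ 2 + k ^ 4)
    ∧ 5 + 2 * k ^ 2 - 2 * Real.sqrt (4 - k ^ 2 + k ^ 4)
        < 5 + 5 * k ^ 2 - 2 * Real.sqrt (4 - 7 * k ^ 2 + 4 * k ^ 4)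
    ∧ 5 + 5 * k ^ 2 - 2 * Real.sqrt (4 - 7 * k ^ 2 + 4 * k ^ 4)
        < 4 + 4 * k ^ 2 := by
  obtain ⟨t, ht⟩ : ∃ t, t = k ^ 2 := ⟨_, rfl⟩
  have h4 : k ^ 4 = t ^ 2 := by rw [ht]; ring
  have ht0 : 0 < t := ht ▸ pow_pos hk0 2
  have ht1 : t < 1 := ht ▸ pow_lt_one₀ hk0.le hk1 two_ne_zero
  rw [h4, ← ht]
  have hsq : 0 < (1 - t) ^ 2 := pow_pos (sub_pos.mpr ht1) 2
  have hA := Real.sq_sqrt (show 0 ≤ 1 - t + 4 * t ^ 2 by nlinarith)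
  have hB := Real.sq_sqrt (show 0 ≤ 4 - t + t ^ 2 by nlinarith)
  have hC := Real.sq_sqrt (show 0 ≤ 4 - 7 * t + 4 * t ^ 2 by nlinarith)
  have hA0 := Real.sqrt_nonneg (1 - t + 4 * t ^ 2)
  have hB0 := Real.sqrt_nonneg (4 - t + t ^ 2)
  have hC0 := Real.sqrt_nonneg (4 - 7 * t + 4 * t ^ 2)
  set A := √(1 - t + 4 * t ^ 2)
  set B := √(4 - t + t ^ 2)
  set C := √(4 - 7 * t + 4 * t ^ 2)
  have hA_lower : 1 + 7 * t < 4 * A :=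
    lt_of_pow_lt_pow_left₀ 2 (by positivity) (by nlinarith)
  have hBA : 2 * B < 3 * (1 - t) + 2 * A := by
    refine lt_of_pow_lt_pow_left₀ 2 (by linarith) ?_
    have := mul_pos (sub_pos.mpr ht1) (sub_pos.mpr hA_lower)
    nlinarith
  have hCB : 2 * C < 3 * t + 2 * B := by
    refine lt_of_pow_lt_pow_left₀ 2 (by positivity) ?_
    have := mul_nonneg ht0.le hB0
    nlinarith
  have hC_lower : 1 + t < 2 * C :=
    lt_of_pow_lt_pow_left₀ 2 (by positivity) (by nlinarith)
  exact ⟨by linarith, by linarith, by linarith⟩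
end
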